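/- Let K be a field and X the set of valuation subrings of K, topologized by declaring the sets E(a) = { R : a ∈ R } for a ∈ K open (subbasis). Then X is quasi-compact; moreover X is a spectral space. -/

import Mathlib

/-- The topology on the Zariski–Riemann space of a field `K`: the set of valuation
subrings of `K`, with open subbasis the sets `E(a) = {R | a ∈ R}` for `a ∈ K \ {0}`. -/
noncomputable instance zrTop (K : Type*) [Field K] :
    TopologicalSpace (ValuationSubring K) :=
  TopologicalSpace.generateFrom
    {U | ∃ a : K, a ≠ 0 ∧ U = {R : ValuationSubring K | a ∈ R}}

/-- The limit of an ultrafilter of valuation subrings. -/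
def zrLim {K : Type*} [Field K] (F : Ultrafilter (ValuationSubring K)) : ValuationSubring K where
  carrier := {a | {R : ValuationSubring K | a ∈ R} ∈ F}
  mul_mem' := by
    intro a b ha hb
    exact Filter.mem_of_superset (Filter.inter_mem ha hb) fun R h => R.mul_mem _ _ h.1 h.2
  one_mem' := Filter.mem_of_superset Filter.univ_mem fun R _ => R.one_mem
  add_mem' := by
    intro a b ha hb
    exact Filter.mem_of_superset (Filter.inter_mem ha hb) fun R h => R.add_mem _ _ h.1 h.2
  zero_mem' := Filter.mem_of_superset Filter.univ_mem fun R _ => R.zero_mem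
  neg_mem' := by
    intro a ha
    exact Filter.mem_of_superset ha fun R h => R.neg_mem _ h
  mem_or_inv_mem' := by
    intro a
    have h : {R : ValuationSubring K | a ∈ R} ∪ {R : ValuationSubring K | a⁻¹ ∈ R} ∈ F :=
      Filter.mem_of_superset Filter.univ_mem fun R _ => R.mem_or_inv_mem a
    exact Ultrafilter.union_mem_iff.1 h

theorem mem_zrLim {K : Type*} [Field K] (F : Ultrafilter (ValuationSubring K)) (a : K) :
    a ∈ zrLim F ↔ {R : ValuationSubring K | a ∈ R} ∈ F := Iff.rfl

theorem zrLim_le {K : Type*} [Field K] (F : Ultrafilter (ValuationSubring K)) :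
    (F : Filter (ValuationSubring K)) ≤ nhds (zrLim F) := by
  rw [TopologicalSpace.nhds_generateFrom]
  refine le_iInf₂ fun s hs => ?_
  obtain ⟨h1, a, -, rfl⟩ := hs
  exact Filter.le_principal_iff.2 h1

/-- Sets clopen for the patch topology. -/
def ZrClopen {K : Type*} [Field K] (S : Set (ValuationSubring K)) : Prop :=
  ∀ F : Ultrafilter (ValuationSubring K), S ∈ F ↔ zrLim F ∈ S

theorem ZrClopen.isCompact {K : Type*} [Field K] {S : Set (ValuationSubring K)}
    (h : ZrClopen S) : IsCompact S := by
  rw [isCompact_iff_ultrafilter_le_nhds]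
  intro F hF
  exact ⟨zrLim F, (h F).1 (Filter.le_principal_iff.1 hF), zrLim_le F⟩

theorem ZrClopen.univ {K : Type*} [Field K] :
    ZrClopen (Set.univ : Set (ValuationSubring K)) :=
  fun _ => iff_of_true Filter.univ_mem trivial

theorem ZrClopen.inter {K : Type*} [Field K] {S T : Set (ValuationSubring K)}
    (h : ZrClopen S) (h' : ZrClopen T) : ZrClopen (S ∩ T) := fun F => by
  rw [Set.mem_inter_iff, ← h F, ← h' F]
  exact Filter.inter_mem_iff

theorem ZrClopen.biUnion {K : Type*} [Field K] {ι : Type*} {t : Set ι} (ht : t.Finite)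
    {S : ι → Set (ValuationSubring K)}
    (h : ∀ i ∈ t, ZrClopen (S i)) : ZrClopen (⋃ i ∈ t, S i) := fun F => by
  rw [Ultrafilter.finite_biUnion_mem_iff ht]
  simp only [Set.mem_iUnion, exists_prop]
  exact exists_congr fun i => and_congr_right fun hi => h i hi F

theorem zr_basis {K : Type*} [Field K] (R : ValuationSubring K) (U : Set (ValuationSubring K))
    (hU : IsOpen U) (hR : R ∈ U) : ∃ V, IsOpen V ∧ ZrClopen V ∧ R ∈ V ∧ V ⊆ U := by
  induction hU with
  | basic s hs =>
    refine ⟨s, .basic s hs, ?_, hR, subset_rfl⟩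
    obtain ⟨a, -, rfl⟩ := hs
    exact fun F => Iff.rfl
  | univ => exact ⟨_, isOpen_univ, .univ, trivial, subset_rfl⟩
  | inter s t _ _ h1 h2 =>
    obtain ⟨V, a1, a2, a3, a4⟩ := h1 hR.1
    obtain ⟨W, b1, b2, b3, b4⟩ := h2 hR.2
    exact ⟨V ∩ W, a1.inter b1, a2.inter b2, ⟨a3, b3⟩, Set.inter_subset_inter a4 b4⟩
  | sUnion S _ h =>
    obtain ⟨s, hs, hRs⟩ := hR
    obtain ⟨V, a1, a2, a3, a4⟩ := h s hs hRs
    exact ⟨V, a1, a2, a3, a4.trans (Set.subset_sUnion_of_mem hs)⟩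

theorem zrClopen_of_isCompact {K : Type*} [Field K] {U : Set (ValuationSubring K)}
    (hU : IsOpen U) (hc : IsCompact U) : ZrClopen U := by
  choose! V h1 h2 h3 h4 using fun R (hR : R ∈ U) => zr_basis R U hU hR
  obtain ⟨t, ht, hcov⟩ := hc.elim_nhds_subcover V fun R hR => (h1 R hR).mem_nhds (h3 R hR)
  have : U = ⋃ x ∈ (t : Set (ValuationSubring K)), V x :=
    Set.Subset.antisymm hcov (Set.iUnion₂_subset fun x hx => h4 x (ht x hx))
  rw [this]
  exact ZrClopen.biUnion t.finite_toSet fun i hi => h2 i (ht i hi)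

theorem zr_generic {K : Type*} [Field K] {Z : Set (ValuationSubring K)}
    (hi : IsIrreducible Z) (hc : IsClosed Z) : ∃ x, IsGenericPoint x Z := by
  let G : Filter (ValuationSubring K) :=
    { sets := {A | ∃ U, IsOpen U ∧ (Z ∩ U).Nonempty ∧ Z ∩ U ⊆ A}
      univ_sets := ⟨Set.univ, isOpen_univ, by simpa using hi.1, Set.subset_univ _⟩
      sets_of_superset := fun ⟨U, h1, h2, h3⟩ h => ⟨U, h1, h2, h3.trans h⟩
      inter_sets := fun ⟨U, h1, h2, h3⟩ ⟨V, k1, k2, k3⟩ =>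
        ⟨U ∩ V, h1.inter k1, hi.2 U V h1 k1 h2 k2, fun x hx =>
          ⟨h3 ⟨hx.1, hx.2.1⟩, k3 ⟨hx.1, hx.2.2⟩⟩⟩ }
  have hG : G.NeBot := by
    refine Filter.neBot_iff.2 fun h => ?_
    have h0 : ∅ ∈ G := by rw [h]; trivial
    obtain ⟨U, -, h2, h3⟩ := h0
    exact (h2.mono h3).ne_empty rfl
  let F := Ultrafilter.of G
  have hF : (F : Filter _) ≤ G := Ultrafilter.of_le G
  have hZ : Z ∈ F := hF ⟨Set.univ, isOpen_univ, by simpa using hi.1, Set.inter_subset_left⟩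
  refine ⟨zrLim F, Set.Subset.antisymm ?_ ?_⟩
  · refine hc.closure_subset_iff.2 (Set.singleton_subset_iff.2 ?_)
    exact isClosed_iff_ultrafilter.1 hc _ F (zrLim_le F) hZ
  · intro R hR
    rw [mem_closure_iff]
    intro U hU hRU
    obtain ⟨V, h1, h2, h3, h4⟩ := zr_basis R U hU hRU
    exact ⟨zrLim F, h4 ((h2 F).1 (hF ⟨V, h1, ⟨R, hR, h3⟩, Set.inter_subset_right⟩)), rfl⟩

/-- The Zariski–Riemann space of a field `K` is quasi-compact; moreover it is a
spectral space: sober, quasi-separated, with a basis of quasi-compact open sets. -/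
theorem zariskiRiemann_quasiCompact_and_spectral (K : Type*) [Field K] :
    CompactSpace (ValuationSubring K) ∧
    QuasiSober (ValuationSubring K) ∧ T0Space (ValuationSubring K) ∧
    QuasiSeparatedSpace (ValuationSubring K) ∧
    (∀ (R : ValuationSubring K) (U : Set (ValuationSubring K)),
      IsOpen U → R ∈ U → ∃ V, IsOpen V ∧ IsCompact V ∧ R ∈ V ∧ V ⊆ U) := by
  refine ⟨⟨ZrClopen.univ.isCompact⟩, ⟨zr_generic⟩, ⟨fun R S h => ?_⟩,
    ⟨fun U V h1 h2 h3 h4 =>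
      ((zrClopen_of_isCompact h1 h2).inter (zrClopen_of_isCompact h3 h4)).isCompact⟩,
    fun R U hU hR => ?_⟩
  · ext a
    by_cases ha : a = 0
    · subst ha
      exact iff_of_true R.zero_mem S.zero_mem
    · exact h.mem_open_iff (s := {R : ValuationSubring K | a ∈ R}) (.basic _ ⟨a, ha, rfl⟩)
  · obtain ⟨V, h1, h2, h3, h4⟩ := zr_basis R U hU hR
    exact ⟨V, h1, h2.isCompact, h3, h4⟩
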